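/- arXiv:1812.04074 — 8 statements merged into one kernel-verified Lean document; each statement's English description precedes it below -/
import Mathlib

section
/- Let D ⊆ ℝⁿ₊₊ be both convex and log-convex, and let f : D → ℝ₊₊ be log-convex (i.e., for all x, y ∈ D and θ ∈ [0,1], f(θx + (1−θ)y) ≤ f(x)^θ f(y)^{1−θ}) and nondecreasing in each of its arguments (x ≤ y entrywise implies f(x) ≤ f(y)). Then f is log-log convex. -/
/-- If `D ⊆ ℝⁿ₊₊` is convex and log-convex, and `f : D → ℝ₊₊` is
log-convex and nondecreasing in each argument, then `f` is log-log convex. -/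
theorem stmt_3 (n : ℕ) (D : Set (Fin n → ℝ)) (f : (Fin n → ℝ) → ℝ)
    (hDpos : ∀ x ∈ D, ∀ i, 0 < x i)
    (hDcvx : Convex ℝ D)
    (hDlog : Convex ℝ {u : Fin n → ℝ | (fun i => Real.exp (u i)) ∈ D})
    (hfpos : ∀ x ∈ D, 0 < f x)
    (hlogcvx : ∀ x ∈ D, ∀ y ∈ D, ∀ θ ∈ Set.Icc (0:ℝ) 1,
      f (θ • x + (1 - θ) • y) ≤ f x ^ θ * f y ^ (1 - θ))
    (hmono : ∀ x ∈ D, ∀ y ∈ D, (∀ i, x i ≤ y i) → f x ≤ f y) :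
    ∀ x ∈ D, ∀ y ∈ D, ∀ θ ∈ Set.Icc (0:ℝ) 1,
      (fun i => x i ^ θ * y i ^ (1 - θ)) ∈ D ∧
        f (fun i => x i ^ θ * y i ^ (1 - θ)) ≤ f x ^ θ * f y ^ (1 - θ) := by
  intro x hx y hy θ ⟨hθ₀, hθ₁⟩
  have hθ₂ : 0 ≤ 1 - θ := sub_nonneg.2 hθ₁
  have exp_log_mem : ∀ z ∈ D, (fun i => Real.log (z i)) ∈
      {u : Fin n → ℝ | (fun i => Real.exp (u i)) ∈ D} := by
    intro z hz
    simpa only [Set.mem_ofPred_eq, Real.exp_log (hDpos z hz _)] using hz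
  have hgeo : (fun i => x i ^ θ * y i ^ (1 - θ)) ∈ D := by
    have h := hDlog (exp_log_mem x hx) (exp_log_mem y hy) hθ₀ hθ₂ (by ring)
    rw [Set.mem_ofPred_eq] at h
    convert h using 2 with i
    simp only [Pi.add_apply, Pi.smul_apply, smul_eq_mul]
    rw [Real.rpow_def_of_pos (hDpos x hx i), Real.rpow_def_of_pos (hDpos y hy i),
      ← Real.exp_add, mul_comm θ, mul_comm (1 - θ)]
  have harith : θ • x + (1 - θ) • y ∈ D := hDcvx hx hy hθ₀ hθ₂ (by ring)
  refine ⟨hgeo, (hmono _ hgeo _ harith fun i => ?_).trans (hlogcvx x hx y hy θ ⟨hθ₀, hθ₁⟩)⟩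
  exact Real.geom_mean_le_arith_mean2_weighted hθ₀ hθ₂ (hDpos x hx i).le (hDpos y hy i).le
    (by ring)
end

section
/- Let D ⊆ ℝⁿ₊₊ be both convex and log-convex, and let f : D → ℝ₊₊ be log-concave (i.e., for all x, y ∈ D and θ ∈ [0,1], f(θx + (1−θ)y) ≥ f(x)^θ f(y)^{1−θ}) and nonincreasing in each of its arguments (x ≤ y entrywise implies f(x) ≥ f(y)). Then f is log-log concave. -/
/-- If `D ⊆ ℝⁿ₊₊` is convex and log-convex, and `f : D → ℝ₊₊` is
log-concave and nonincreasing in each argument, then `f` is log-log concave. -/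
theorem stmt_4 (n : ℕ) (D : Set (Fin n → ℝ)) (f : (Fin n → ℝ) → ℝ)
    (hDpos : ∀ x ∈ D, ∀ i, 0 < x i)
    (hDcvx : Convex ℝ D)
    (hDlog : Convex ℝ {u : Fin n → ℝ | (fun i => Real.exp (u i)) ∈ D})
    (hfpos : ∀ x ∈ D, 0 < f x)
    (hlogccv : ∀ x ∈ D, ∀ y ∈ D, ∀ θ ∈ Set.Icc (0:ℝ) 1,
      f x ^ θ * f y ^ (1 - θ) ≤ f (θ • x + (1 - θ) • y))
    (hmono : ∀ x ∈ D, ∀ y ∈ D, (∀ i, x i ≤ y i) → f y ≤ f x) :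
    ∀ x ∈ D, ∀ y ∈ D, ∀ θ ∈ Set.Icc (0:ℝ) 1,
      (fun i => x i ^ θ * y i ^ (1 - θ)) ∈ D ∧
        f x ^ θ * f y ^ (1 - θ) ≤ f (fun i => x i ^ θ * y i ^ (1 - θ)) := by
  intro x hx y hy θ hθ
  have hθ' : 0 ≤ 1 - θ := sub_nonneg.mpr hθ.2
  have hsum : θ + (1 - θ) = 1 := add_sub_cancel θ 1
  have exp_log_mem : ∀ z ∈ D, (fun i => Real.exp (Real.log (z i))) ∈ D := by
    intro z hz
    simpa only [Real.exp_log (hDpos z hz _)] using hz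
  have hmem : (fun i => x i ^ θ * y i ^ (1 - θ)) ∈ D := by
    have h := hDlog (x := fun i => Real.log (x i)) (exp_log_mem x hx)
      (y := fun i => Real.log (y i)) (exp_log_mem y hy) hθ.1 hθ' hsum
    rw [Set.mem_ofPred_eq] at h
    convert h using 2 with i
    rw [Real.rpow_def_of_pos (hDpos x hx i), Real.rpow_def_of_pos (hDpos y hy i), ← Real.exp_add]
    simp [mul_comm]
  refine ⟨hmem, (hlogccv x hx y hy θ hθ).trans ?_⟩
  refine hmono _ hmem _ (hDcvx hx hy hθ.1 hθ' hsum) fun i => ?_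
  exact Real.geom_mean_le_arith_mean2_weighted hθ.1 hθ' (hDpos x hx i).le (hDpos y hy i).le hsum
end

section
/- Let D ⊆ ℝⁿ₊₊ be convex, and let f : D → ℝ₊₊ be log-log convex and nonincreasing in each of its arguments (x ≤ y entrywise implies f(x) ≥ f(y)). Then f is log-convex: for all x, y ∈ D and θ ∈ [0,1], f(θx + (1−θ)y) ≤ f(x)^θ f(y)^{1−θ}. -/
/-- If `D ⊆ ℝⁿ₊₊` is convex and `f : D → ℝ₊₊` is log-log convex
and nonincreasing in each argument, then `f` is log-convex. -/
theorem stmt_5 (n : ℕ) (D : Set (Fin n → ℝ)) (f : (Fin n → ℝ) → ℝ)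
    (hDpos : ∀ x ∈ D, ∀ i, 0 < x i)
    (hDcvx : Convex ℝ D)
    (hfpos : ∀ x ∈ D, 0 < f x)
    (hllcvx : ∀ x ∈ D, ∀ y ∈ D, ∀ θ ∈ Set.Icc (0:ℝ) 1,
      (fun i => x i ^ θ * y i ^ (1 - θ)) ∈ D ∧
        f (fun i => x i ^ θ * y i ^ (1 - θ)) ≤ f x ^ θ * f y ^ (1 - θ))
    (hmono : ∀ x ∈ D, ∀ y ∈ D, (∀ i, x i ≤ y i) → f y ≤ f x) :
    ∀ x ∈ D, ∀ y ∈ D, ∀ θ ∈ Set.Icc (0:ℝ) 1,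
      f (θ • x + (1 - θ) • y) ≤ f x ^ θ * f y ^ (1 - θ) := by
  intro x hx y hy θ hθ
  obtain ⟨hmem, hle⟩ := hllcvx x hx y hy θ hθ
  have hθ' : 0 ≤ 1 - θ := sub_nonneg.2 hθ.2
  refine (hmono _ hmem _ (hDcvx hx hy hθ.1 hθ' (add_sub_cancel θ 1)) fun i => ?_).trans hle
  exact Real.geom_mean_le_arith_mean2_weighted hθ.1 hθ' (hDpos x hx i).le (hDpos y hy i).le
    (add_sub_cancel θ 1)
end

section
/- Let D ⊆ ℝⁿ₊₊ be convex, and let f : D → ℝ₊₊ be log-log concave and nondecreasing in each of its arguments (x ≤ y entrywise implies f(x) ≤ f(y)). Then f is log-concave: for all x, y ∈ D and θ ∈ [0,1], f(θx + (1−θ)y) ≥ f(x)^θ f(y)^{1−θ}. -/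
/-- If `D ⊆ ℝⁿ₊₊` is convex and `f : D → ℝ₊₊` is log-log concave
and nondecreasing in each argument, then `f` is log-concave. -/
theorem stmt_6 (n : ℕ) (D : Set (Fin n → ℝ)) (f : (Fin n → ℝ) → ℝ)
    (hDpos : ∀ x ∈ D, ∀ i, 0 < x i)
    (hDcvx : Convex ℝ D)
    (hfpos : ∀ x ∈ D, 0 < f x)
    (hllccv : ∀ x ∈ D, ∀ y ∈ D, ∀ θ ∈ Set.Icc (0:ℝ) 1,
      (fun i => x i ^ θ * y i ^ (1 - θ)) ∈ D ∧
        f x ^ θ * f y ^ (1 - θ) ≤ f (fun i => x i ^ θ * y i ^ (1 - θ)))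
    (hmono : ∀ x ∈ D, ∀ y ∈ D, (∀ i, x i ≤ y i) → f x ≤ f y) :
    ∀ x ∈ D, ∀ y ∈ D, ∀ θ ∈ Set.Icc (0:ℝ) 1,
      f x ^ θ * f y ^ (1 - θ) ≤ f (θ • x + (1 - θ) • y) := by
  intro x hx y hy θ hθ
  obtain ⟨hmem, hle⟩ := hllccv x hx y hy θ hθ
  have hθ' : 0 ≤ 1 - θ := sub_nonneg.mpr hθ.2
  have hsum : θ + (1 - θ) = 1 := add_sub_cancel θ 1
  refine hle.trans (hmono _ hmem _ (hDcvx hx hy hθ.1 hθ' hsum) fun i => ?_)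
  exact Real.geom_mean_le_arith_mean2_weighted hθ.1 hθ'
    (hDpos x hx i).le (hDpos y hy i).le hsum
end

section
/- Let a > 0 and let f : [0, a) → [0, ∞) be continuous and log-log convex on (0, a). Then the function g(x) = ∫₀ˣ f(t) dt is log-log convex on (0, a): for all x, y ∈ (0, a) and θ ∈ [0,1], g(x^θ y^{1−θ}) ≤ g(x)^θ g(y)^{1−θ}. -/
open MeasureTheory in
/-- Hölder's inequality for a weighted geometric mean of two nonnegative continuous functions on a
compact interval. -/
theorem intervalIntegral_rpow_mul_rpow_le {b c : ℝ} (hbc : b ≤ c) {u v : ℝ → ℝ}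
    (hu : ContinuousOn u (Set.Icc b c)) (hv : ContinuousOn v (Set.Icc b c))
    (hu0 : ∀ s ∈ Set.Icc b c, 0 ≤ u s) (hv0 : ∀ s ∈ Set.Icc b c, 0 ≤ v s)
    {θ : ℝ} (hθ : 0 < θ) (hθ1 : θ < 1) :
    ∫ s in b..c, u s ^ θ * v s ^ (1 - θ) ≤
      (∫ s in b..c, u s) ^ θ * (∫ s in b..c, v s) ^ (1 - θ) := by
  have memLp_rpow : ∀ {w : ℝ → ℝ} {r : ℝ}, ContinuousOn w (Set.Icc b c) → 0 < r →
      ∀ p, MemLp (fun s => w s ^ r) p (volume.restrict (Set.Ioc b c)) := by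
    intro w r hw hr p
    have hwr : ContinuousOn (fun s => w s ^ r) (Set.Icc b c) :=
      hw.rpow_const fun _ _ => Or.inr hr.le
    obtain ⟨C, hC⟩ := isCompact_Icc.exists_bound_of_continuousOn hwr
    refine MemLp.of_bound
      ((hwr.mono Set.Ioc_subset_Icc_self).aestronglyMeasurable measurableSet_Ioc) C ?_
    filter_upwards [ae_restrict_mem measurableSet_Ioc] with s hs
    exact hC s (Set.Ioc_subset_Icc_self hs)
  have rpow_nonneg_ae : ∀ {w : ℝ → ℝ} {r : ℝ}, (∀ s ∈ Set.Icc b c, 0 ≤ w s) →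
      0 ≤ᵐ[volume.restrict (Set.Ioc b c)] fun s => w s ^ r := by
    intro w r hw
    filter_upwards [ae_restrict_mem measurableSet_Ioc] with s hs
    exact Real.rpow_nonneg (hw s (Set.Ioc_subset_Icc_self hs)) r
  have integral_rpow_inv : ∀ {w : ℝ → ℝ} {r : ℝ}, (∀ s ∈ Set.Icc b c, 0 ≤ w s) → 0 < r →
      ∫ s in Set.Ioc b c, (w s ^ r) ^ r⁻¹ = ∫ s in Set.Ioc b c, w s := by
    intro w r hw hr
    refine setIntegral_congr_fun measurableSet_Ioc fun s hs => ?_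
    exact Real.rpow_rpow_inv (hw s (Set.Ioc_subset_Icc_self hs)) hr.ne'
  have hθ' : 0 < 1 - θ := sub_pos.2 hθ1
  have holder := integral_mul_le_Lp_mul_Lq_of_nonneg (Real.HolderConjugate.inv_one_sub_inv hθ hθ1)
    (rpow_nonneg_ae hu0) (rpow_nonneg_ae hv0) (memLp_rpow hu hθ _) (memLp_rpow hv hθ' _)
  rw [integral_rpow_inv hu0 hθ, integral_rpow_inv hv0 hθ'] at holder
  simpa only [intervalIntegral.integral_of_le hbc, one_div, inv_inv] using holder

/-- If `f : [0, a) → [0, ∞)` is continuous and log-log convex on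
`(0, a)`, then `g(x) = ∫₀ˣ f(t) dt` is log-log convex on `(0, a)`. -/
theorem stmt_9 (a : ℝ) (ha : 0 < a) (f : ℝ → ℝ)
    (hcont : ContinuousOn f (Set.Ico 0 a))
    (hnonneg : ∀ t ∈ Set.Ico (0:ℝ) a, 0 ≤ f t)
    (hllc : ∀ x ∈ Set.Ioo (0:ℝ) a, ∀ y ∈ Set.Ioo (0:ℝ) a, ∀ θ ∈ Set.Icc (0:ℝ) 1,
      f (x ^ θ * y ^ (1 - θ)) ≤ f x ^ θ * f y ^ (1 - θ)) :
    ∀ x ∈ Set.Ioo (0:ℝ) a, ∀ y ∈ Set.Ioo (0:ℝ) a, ∀ θ ∈ Set.Icc (0:ℝ) 1,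
      (∫ t in (0:ℝ)..(x ^ θ * y ^ (1 - θ)), f t) ≤
        (∫ t in (0:ℝ)..x, f t) ^ θ * (∫ t in (0:ℝ)..y, f t) ^ (1 - θ) := by
  intro x hx y hy θ hθ
  rcases hθ.1.eq_or_lt with rfl | hθ0
  · simp
  rcases hθ.2.eq_or_lt with rfl | hθ1
  · simp
  have hθ' : 0 < 1 - θ := sub_pos.2 hθ1
  have hz : x ^ θ * y ^ (1 - θ) ∈ Set.Ioo (0:ℝ) a := by
    refine ⟨mul_pos (Real.rpow_pos_of_pos hx.1 _) (Real.rpow_pos_of_pos hy.1 _), ?_⟩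
    have := Real.geom_mean_le_arith_mean2_weighted hθ0.le hθ'.le hx.1.le hy.1.le (by ring)
    nlinarith [hx.2, hy.2]
  have rescale_mem : ∀ {w : ℝ}, w ∈ Set.Ioo (0:ℝ) a →
      ∀ s ∈ Set.Icc (0:ℝ) 1, w * s ∈ Set.Ico (0:ℝ) a := fun hw s hs =>
    ⟨mul_nonneg hw.1.le hs.1, (mul_le_of_le_one_right hw.1.le hs.2).trans_lt hw.2⟩
  have rescale_cont : ∀ {w : ℝ}, w ∈ Set.Ioo (0:ℝ) a →
      ContinuousOn (fun s => f (w * s)) (Set.Icc 0 1) := fun hw =>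
    hcont.comp (by fun_prop) (rescale_mem hw)
  have rescale_integral : ∀ w : ℝ, ∫ t in (0:ℝ)..w, f t = w * ∫ s in (0:ℝ)..1, f (w * s) := by
    intro w
    rw [intervalIntegral.mul_integral_comp_mul_left, mul_zero, mul_one]
  have rescale_integral_nonneg : ∀ {w : ℝ}, w ∈ Set.Ioo (0:ℝ) a →
      0 ≤ ∫ s in (0:ℝ)..1, f (w * s) := fun hw =>
    intervalIntegral.integral_nonneg zero_le_one fun s hs => hnonneg _ (rescale_mem hw s hs)
  have pointwise : ∀ s ∈ Set.Ioo (0:ℝ) 1,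
      f (x ^ θ * y ^ (1 - θ) * s) ≤ f (x * s) ^ θ * f (y * s) ^ (1 - θ) := by
    intro s hs
    have hs' := Set.Ioo_subset_Icc_self hs
    have h := hllc (x * s) ⟨mul_pos hx.1 hs.1, (rescale_mem hx s hs').2⟩
      (y * s) ⟨mul_pos hy.1 hs.1, (rescale_mem hy s hs').2⟩ θ hθ
    have hsplit : s ^ θ * s ^ (1 - θ) = s := by
      rw [← Real.rpow_add hs.1, add_sub_cancel, Real.rpow_one]
    rwa [Real.mul_rpow hx.1.le hs.1.le, Real.mul_rpow hy.1.le hs.1.le, mul_mul_mul_comm,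
      hsplit] at h
  have key : ∫ s in (0:ℝ)..1, f (x ^ θ * y ^ (1 - θ) * s) ≤
      (∫ s in (0:ℝ)..1, f (x * s)) ^ θ * (∫ s in (0:ℝ)..1, f (y * s)) ^ (1 - θ) := by
    refine le_trans (intervalIntegral.integral_mono_on_of_le_Ioo zero_le_one
      ((rescale_cont hz).intervalIntegrable_of_Icc zero_le_one)
      (ContinuousOn.intervalIntegrable_of_Icc zero_le_one ?_) pointwise)
      (intervalIntegral_rpow_mul_rpow_le zero_le_one (rescale_cont hx) (rescale_cont hy)
        (fun s hs => hnonneg _ (rescale_mem hx s hs))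
        (fun s hs => hnonneg _ (rescale_mem hy s hs)) hθ0 hθ1)
    exact ((rescale_cont hx).rpow_const fun _ _ => Or.inr hθ0.le).mul
      ((rescale_cont hy).rpow_const fun _ _ => Or.inr hθ'.le)
  rw [rescale_integral (x ^ θ * y ^ (1 - θ)), rescale_integral x, rescale_integral y,
    Real.mul_rpow hx.1.le (rescale_integral_nonneg hx),
    Real.mul_rpow hy.1.le (rescale_integral_nonneg hy), mul_mul_mul_comm]
  exact mul_le_mul_of_nonneg_left key hz.1.le
end

section
/- Let a > 0 and let f : [0, a) → [0, ∞) be continuous and log-log concave on (0, a). Then the function g(x) = ∫₀ˣ f(t) dt is log-log concave on (0, a): for all x, y ∈ (0, a) and θ ∈ [0,1], g(x^θ y^{1−θ}) ≥ g(x)^θ g(y)^{1−θ}. -/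
theorem mul_le_mul_of_logLogConcave {a : ℝ} {f : ℝ → ℝ}
    (hnonneg : ∀ t ∈ Set.Ico (0:ℝ) a, 0 ≤ f t)
    (hllc : ∀ x ∈ Set.Ioo (0:ℝ) a, ∀ y ∈ Set.Ioo (0:ℝ) a, ∀ θ ∈ Set.Icc (0:ℝ) 1,
      f x ^ θ * f y ^ (1 - θ) ≤ f (x ^ θ * y ^ (1 - θ)))
    {x y r : ℝ} (hx : 0 < x) (hxy : x < y) (hya : y < a) (hr : 0 < r) (hr1 : r ≤ 1) :
    f y * f (x * r) ≤ f x * f (y * r) := by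
  have hy : 0 < y := hx.trans hxy
  have hxr : 0 < x * r := mul_pos hx hr
  have hxr_a : x * r < a := by nlinarith
  have hlog : Real.log x < Real.log y := Real.log_lt_log hx hxy
  have hlogr : Real.log r ≤ 0 := Real.log_nonpos hr.le hr1
  have hd : 0 < Real.log y - Real.log x - Real.log r := by linarith
  obtain ⟨α, hα⟩ : ∃ α, α = -Real.log r / (Real.log y - Real.log x - Real.log r) := ⟨_, rfl⟩
  have hα0 : 0 ≤ α := hα ▸ div_nonneg (by linarith) hd.le
  have hα1 : α ≤ 1 := by rw [hα, div_le_one hd]; linarith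
  have hmul : α * (Real.log y - Real.log x - Real.log r) = -Real.log r := by
    rw [hα, div_mul_cancel₀ _ hd.ne']
  have e1 : y ^ α * (x * r) ^ (1 - α) = x := by
    rw [Real.rpow_def_of_pos hy, Real.rpow_def_of_pos hxr, ← Real.exp_add,
      Real.log_mul hx.ne' hr.ne']
    conv_rhs => rw [← Real.exp_log hx]
    congr 1
    linear_combination hmul
  have e2 : y ^ (1 - α) * (x * r) ^ (1 - (1 - α)) = y * r := by
    rw [Real.rpow_def_of_pos hy, Real.rpow_def_of_pos hxr, ← Real.exp_add,
      Real.log_mul hx.ne' hr.ne']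
    conv_rhs => rw [← Real.exp_log (mul_pos hy hr), Real.log_mul hy.ne' hr.ne']
    congr 1
    linear_combination -hmul
  have h1 := hllc y ⟨hy, hya⟩ (x * r) ⟨hxr, hxr_a⟩ α ⟨hα0, hα1⟩
  have h2 := hllc y ⟨hy, hya⟩ (x * r) ⟨hxr, hxr_a⟩ (1 - α) ⟨by linarith, by linarith⟩
  rw [e1] at h1
  rw [e2] at h2
  have hfy := hnonneg y ⟨hy.le, hya⟩
  have hfxr := hnonneg (x * r) ⟨hxr.le, hxr_a⟩
  have hsplit : ∀ c : ℝ, 0 ≤ c → c ^ α * c ^ (1 - α) = c := fun c hc => by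
    rw [← Real.rpow_add' hc (by simp)]; simp
  have h3 := mul_le_mul h1 h2 (by positivity) (hnonneg x ⟨hx.le, hxy.trans hya⟩)
  rw [sub_sub_cancel] at h3
  calc f y * f (x * r)
      = (f y ^ α * f y ^ (1 - α)) * (f (x * r) ^ α * f (x * r) ^ (1 - α)) := by
        rw [hsplit _ hfy, hsplit _ hfxr]
    _ = f y ^ α * f (x * r) ^ (1 - α) * (f y ^ (1 - α) * f (x * r) ^ α) := by ring
    _ ≤ _ := h3

theorem integral_eq_mul_integral_comp_mul (f : ℝ → ℝ) (x : ℝ) :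
    ∫ t in (0:ℝ)..x, f t = x * ∫ r in (0:ℝ)..1, f (x * r) := by
  rw [intervalIntegral.mul_integral_comp_mul_left]; simp

theorem mul_integral_le_mul_integral_of_logLogConcave {a : ℝ} {f : ℝ → ℝ}
    (hcont : ContinuousOn f (Set.Ico 0 a))
    (hnonneg : ∀ t ∈ Set.Ico (0:ℝ) a, 0 ≤ f t)
    (hllc : ∀ x ∈ Set.Ioo (0:ℝ) a, ∀ y ∈ Set.Ioo (0:ℝ) a, ∀ θ ∈ Set.Icc (0:ℝ) 1,
      f x ^ θ * f y ^ (1 - θ) ≤ f (x ^ θ * y ^ (1 - θ)))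
    {x y : ℝ} (hx : 0 < x) (hxy : x < y) (hya : y < a) :
    y * f y * ∫ t in (0:ℝ)..x, f t ≤ x * f x * ∫ t in (0:ℝ)..y, f t := by
  have hy : 0 < y := hx.trans hxy
  have hint : ∀ z, 0 < z → z < a → ∀ c : ℝ,
      IntervalIntegrable (fun r => c * f (z * r)) MeasureTheory.volume 0 1 := by
    intro z hz hza c
    apply ContinuousOn.intervalIntegrable_of_Icc zero_le_one
    refine continuousOn_const.mul (hcont.comp (by fun_prop) fun r hr => ?_)
    exact ⟨mul_nonneg hz.le hr.1, by nlinarith [hr.2]⟩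
  have key : ∫ r in (0:ℝ)..1, f y * f (x * r) ≤ ∫ r in (0:ℝ)..1, f x * f (y * r) := by
    refine intervalIntegral.integral_mono_on_of_le_Ioo zero_le_one
      (hint x hx (hxy.trans hya) _) (hint y hy hya _) fun r hr => ?_
    exact mul_le_mul_of_logLogConcave hnonneg hllc hx hxy hya hr.1 hr.2.le
  rw [intervalIntegral.integral_const_mul, intervalIntegral.integral_const_mul] at key
  rw [integral_eq_mul_integral_comp_mul f x, integral_eq_mul_integral_comp_mul f y]
  have := mul_le_mul_of_nonneg_left key (mul_pos hx hy).le
  linarith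

/-- If `f : [0, a) → [0, ∞)` is continuous and log-log concave on
`(0, a)`, then `g(x) = ∫₀ˣ f(t) dt` is log-log concave on `(0, a)`. -/
theorem stmt_10 (a : ℝ) (ha : 0 < a) (f : ℝ → ℝ)
    (hcont : ContinuousOn f (Set.Ico 0 a))
    (hnonneg : ∀ t ∈ Set.Ico (0:ℝ) a, 0 ≤ f t)
    (hllc : ∀ x ∈ Set.Ioo (0:ℝ) a, ∀ y ∈ Set.Ioo (0:ℝ) a, ∀ θ ∈ Set.Icc (0:ℝ) 1,
      f x ^ θ * f y ^ (1 - θ) ≤ f (x ^ θ * y ^ (1 - θ))) :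
    ∀ x ∈ Set.Ioo (0:ℝ) a, ∀ y ∈ Set.Ioo (0:ℝ) a, ∀ θ ∈ Set.Icc (0:ℝ) 1,
      (∫ t in (0:ℝ)..x, f t) ^ θ * (∫ t in (0:ℝ)..y, f t) ^ (1 - θ) ≤
        ∫ t in (0:ℝ)..(x ^ θ * y ^ (1 - θ)), f t := by
  intro x hx y hy θ hθ
  obtain ⟨g, hg⟩ : ∃ g : ℝ → ℝ, g = fun z => ∫ t in (0:ℝ)..z, f t := ⟨_, rfl⟩
  have hgz : ∀ z, ∫ t in (0:ℝ)..z, f t = g z := fun z => by rw [hg]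
  simp only [hgz]
  have hint : ∀ u v, 0 ≤ u → u ≤ v → v < a →
      IntervalIntegrable f MeasureTheory.volume u v := fun u v hu huv hva =>
    (hcont.mono fun t ht => ⟨hu.trans ht.1, ht.2.trans_lt hva⟩).intervalIntegrable_of_Icc huv
  have hmono : ∀ u v, 0 ≤ u → u ≤ v → v < a → g u ≤ g v := by
    intro u v hu huv hva
    rw [hg]
    have h := intervalIntegral.integral_add_adjacent_intervals
      (hint 0 u le_rfl hu (huv.trans_lt hva)) (hint u v hu huv hva)
    have h' : 0 ≤ ∫ t in u..v, f t := intervalIntegral.integral_nonneg huv fun t ht =>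
      hnonneg t ⟨hu.trans ht.1, ht.2.trans_lt hva⟩
    dsimp only
    linarith
  have hg0 : g 0 = 0 := by simp [hg]
  have hgnn : ∀ z, 0 ≤ z → z < a → 0 ≤ g z := fun z hz hza => hg0 ▸ hmono 0 z le_rfl hz hza
  have hexp : x ^ θ * y ^ (1 - θ) = Real.exp (θ * Real.log x + (1 - θ) * Real.log y) := by
    rw [Real.rpow_def_of_pos hx.1, Real.rpow_def_of_pos hy.1, ← Real.exp_add]
    ring_nf
  have hlt : ∀ u, Real.exp u < a ↔ u < Real.log a := fun u => (Real.lt_log_iff_exp_lt ha).symm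
  have hlx : Real.log x < Real.log a := Real.log_lt_log hx.1 hx.2
  have hly : Real.log y < Real.log a := Real.log_lt_log hy.1 hy.2
  have hz0 : 0 < x ^ θ * y ^ (1 - θ) := hexp ▸ Real.exp_pos _
  have hza : x ^ θ * y ^ (1 - θ) < a := by
    rw [hexp, hlt]
    exact (convex_Iio (𝕜 := ℝ) (Real.log a)) hlx hly hθ.1 (sub_nonneg.2 hθ.2) (by ring)
  rcases hθ.1.eq_or_lt with rfl | hθ0
  · simp
  rcases hθ.2.eq_or_lt with rfl | hθ1
  · simp
  rcases (hgnn x hx.1.le hx.2).eq_or_lt with hgx | hgx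
  · rw [← hgx, Real.zero_rpow hθ0.ne', zero_mul]
    exact hgnn _ hz0.le hza
  rcases (hgnn y hy.1.le hy.2).eq_or_lt with hgy | hgy
  · rw [← hgy, Real.zero_rpow (sub_pos.2 hθ1).ne', mul_zero]
    exact hgnn _ hz0.le hza
  obtain ⟨m, hm0, hmx, hmy, hgm⟩ : ∃ m, 0 < m ∧ m ≤ x ∧ m ≤ y ∧ 0 < g m := by
    rcases le_total x y with h | h
    · exact ⟨x, hx.1, le_rfl, h, hgx⟩
    · exact ⟨y, hy.1, h, le_rfl, hgy⟩
  have hpos : ∀ u ∈ Set.Ico (Real.log m) (Real.log a), 0 < g (Real.exp u) := fun u hu =>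
    hgm.trans_le (hmono _ _ hm0.le ((Real.log_le_iff_le_exp hm0).1 hu.1) ((hlt u).2 hu.2))
  have hderiv : ∀ u ∈ Set.Ico (Real.log m) (Real.log a),
      HasDerivAt (fun u => Real.log (g (Real.exp u)))
        (f (Real.exp u) * Real.exp u / g (Real.exp u)) u := by
    intro u hu
    have hu' : Real.exp u ∈ Set.Ioo 0 a := ⟨Real.exp_pos u, (hlt u).2 hu.2⟩
    have hcontAt : ContinuousAt f (Real.exp u) :=
      hcont.continuousAt (Ico_mem_nhds hu'.1 hu'.2)
    have hd : HasDerivAt g (f (Real.exp u)) (Real.exp u) := by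
      rw [hg]
      refine intervalIntegral.integral_hasDerivAt_right (hint _ _ le_rfl hu'.1.le hu'.2) ?_ hcontAt
      exact (hcont.mono Set.Ioo_subset_Ico_self).stronglyMeasurableAtFilter isOpen_Ioo _ hu'
    exact (hd.comp u (Real.hasDerivAt_exp u)).log (hpos u hu).ne'
  have hconc : ConcaveOn ℝ (Set.Ico (Real.log m) (Real.log a))
      (fun u => Real.log (g (Real.exp u))) := by
    refine AntitoneOn.concaveOn_of_deriv (convex_Ico _ _)
      (fun u hu => (hderiv u hu).continuousAt.continuousWithinAt)
      (fun u hu => (hderiv u (interior_subset hu)).differentiableAt.differentiableWithinAt) ?_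
    intro u hu v hv huv
    have hu := interior_subset hu
    have hv := interior_subset hv
    rw [(hderiv u hu).deriv, (hderiv v hv).deriv, div_le_div_iff₀ (hpos v hv) (hpos u hu)]
    rcases huv.eq_or_lt with rfl | huv
    · exact le_rfl
    have := mul_integral_le_mul_integral_of_logLogConcave hcont hnonneg hllc
      (Real.exp_pos u) (Real.exp_lt_exp.2 huv) ((hlt v).2 hv.2)
    simp only [hgz] at this
    linarith
  have hmemx : Real.log x ∈ Set.Ico (Real.log m) (Real.log a) := ⟨Real.log_le_log hm0 hmx, hlx⟩
  have hmemy : Real.log y ∈ Set.Ico (Real.log m) (Real.log a) := ⟨Real.log_le_log hm0 hmy, hly⟩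
  have hle := hconc.2 hmemx hmemy hθ.1 (sub_nonneg.2 hθ.2) (by ring)
  have hmemz := hconc.1 hmemx hmemy hθ.1 (sub_nonneg.2 hθ.2) (by ring)
  simp only [smul_eq_mul, Real.exp_log hx.1, Real.exp_log hy.1] at hle hmemz
  rw [hexp, Real.rpow_def_of_pos hgx, Real.rpow_def_of_pos hgy, ← Real.exp_add,
    ← Real.le_log_iff_exp_le (hpos _ hmemz)]
  linarith
end

section
/- If f, g : D → ℝ₊₊ with D ⊆ ℝⁿ₊₊ are both log-log convex, then their sum f + g is log-log convex: for all x, y ∈ D and θ ∈ [0,1], f(x^θ ∘ y^{1−θ}) + g(x^θ ∘ y^{1−θ}) ≤ (f(x) + g(x))^θ (f(y) + g(y))^{1−θ}. -/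
/-- Two-term Hölder inequality for weighted geometric means. -/
theorem Real.rpow_mul_rpow_add_le {a b c d θ : ℝ} (ha : 0 < a) (hb : 0 < b) (hc : 0 < c)
    (hd : 0 < d) (hθ : θ ∈ Set.Icc (0:ℝ) 1) :
    a ^ θ * c ^ (1 - θ) + b ^ θ * d ^ (1 - θ) ≤ (a + b) ^ θ * (c + d) ^ (1 - θ) := by
  have hθ' : 0 ≤ 1 - θ := sub_nonneg.2 hθ.2
  have hab : 0 < a + b := by positivity
  have hcd : 0 < c + d := by positivity
  have amgm {u v : ℝ} (hu : 0 < u) (hv : 0 < v) :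
      u ^ θ * v ^ (1 - θ) / ((a + b) ^ θ * (c + d) ^ (1 - θ)) ≤
        θ * (u / (a + b)) + (1 - θ) * (v / (c + d)) := by
    rw [mul_div_mul_comm, ← Real.div_rpow hu.le hab.le, ← Real.div_rpow hv.le hcd.le]
    exact Real.geom_mean_le_arith_mean2_weighted hθ.1 hθ' (by positivity) (by positivity)
      (by ring)
  have hsum : θ * (a / (a + b)) + (1 - θ) * (c / (c + d)) +
      (θ * (b / (a + b)) + (1 - θ) * (d / (c + d))) = 1 := by
    field_simp
    ring
  have h := add_le_add (amgm ha hc) (amgm hb hd)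
  rwa [hsum, ← add_div, div_le_one (by positivity)] at h

/-- The sum of two log-log convex functions is log-log convex. -/
theorem stmt_12 (n : ℕ) (D : Set (Fin n → ℝ)) (f g : (Fin n → ℝ) → ℝ)
    (hDpos : ∀ x ∈ D, ∀ i, 0 < x i)
    (hfpos : ∀ x ∈ D, 0 < f x) (hgpos : ∀ x ∈ D, 0 < g x)
    (hf : ∀ x ∈ D, ∀ y ∈ D, ∀ θ ∈ Set.Icc (0:ℝ) 1,
      (fun i => x i ^ θ * y i ^ (1 - θ)) ∈ D ∧
        f (fun i => x i ^ θ * y i ^ (1 - θ)) ≤ f x ^ θ * f y ^ (1 - θ))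
    (hg : ∀ x ∈ D, ∀ y ∈ D, ∀ θ ∈ Set.Icc (0:ℝ) 1,
      (fun i => x i ^ θ * y i ^ (1 - θ)) ∈ D ∧
        g (fun i => x i ^ θ * y i ^ (1 - θ)) ≤ g x ^ θ * g y ^ (1 - θ)) :
    ∀ x ∈ D, ∀ y ∈ D, ∀ θ ∈ Set.Icc (0:ℝ) 1,
      f (fun i => x i ^ θ * y i ^ (1 - θ)) + g (fun i => x i ^ θ * y i ^ (1 - θ)) ≤
        (f x + g x) ^ θ * (f y + g y) ^ (1 - θ) := by
  intro x hx y hy θ hθ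
  exact (add_le_add (hf x hx y hy θ hθ).2 (hg x hx y hy θ hθ).2).trans
    (Real.rpow_mul_rpow_add_le (hfpos x hx) (hgpos x hx) (hfpos y hy) (hgpos y hy) hθ)
end

section
/- For 1 ≤ r ≤ n, the function that maps x ∈ ℝⁿ₊₊ to the sum of its r largest entries is log-log convex: for all x, y ∈ ℝⁿ₊₊ and θ ∈ [0,1], sum_largest_r(x^θ ∘ y^{1−θ}) ≤ sum_largest_r(x)^θ · sum_largest_r(y)^{1−θ}. -/
/-- The sum of the `r` largest entries of `x ∈ ℝⁿ₊₊`, expressed as the maximum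
of the sums of `x` over all index sets of cardinality `r`. -/
noncomputable def sumLargest (n r : ℕ) (x : Fin n → ℝ) : ℝ :=
  sSup ((fun S : Finset (Fin n) => ∑ i ∈ S, x i) '' {S : Finset (Fin n) | S.card = r})

open Finset in
/-- **Hölder's inequality** in log-log convex form, with upper bounds in place of the sums. -/
theorem sum_rpow_mul_rpow_le {ι : Type*} (s : Finset ι) {x y : ι → ℝ} {a b θ : ℝ}
    (hx : ∀ i ∈ s, 0 ≤ x i) (hy : ∀ i ∈ s, 0 ≤ y i) (ha : 0 < a) (hb : 0 < b)
    (hxa : ∑ i ∈ s, x i ≤ a) (hyb : ∑ i ∈ s, y i ≤ b) (hθ : θ ∈ Set.Icc (0 : ℝ) 1) :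
    ∑ i ∈ s, x i ^ θ * y i ^ (1 - θ) ≤ a ^ θ * b ^ (1 - θ) := by
  have hθ₀ : 0 ≤ θ := hθ.1
  have hθ₁ : 0 ≤ 1 - θ := sub_nonneg.2 hθ.2
  have hc : 0 < a ^ θ * b ^ (1 - θ) := by positivity
  rw [← div_le_one hc, sum_div]
  calc
    ∑ i ∈ s, x i ^ θ * y i ^ (1 - θ) / (a ^ θ * b ^ (1 - θ))
        ≤ ∑ i ∈ s, (θ * (x i / a) + (1 - θ) * (y i / b)) := by
      refine sum_le_sum fun i hi => ?_
      rw [mul_div_mul_comm, ← Real.div_rpow (hx i hi) ha.le, ← Real.div_rpow (hy i hi) hb.le]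
      exact Real.geom_mean_le_arith_mean2_weighted hθ₀ hθ₁ (div_nonneg (hx i hi) ha.le)
        (div_nonneg (hy i hi) hb.le) (by ring)
    _ = θ * ((∑ i ∈ s, x i) / a) + (1 - θ) * ((∑ i ∈ s, y i) / b) := by
      rw [sum_add_distrib, ← mul_sum, ← mul_sum, sum_div, sum_div]
    _ ≤ θ * 1 + (1 - θ) * 1 := by
      have hxa₁ := (div_le_one ha).2 hxa
      have hyb₁ := (div_le_one hb).2 hyb
      gcongr
    _ = 1 := by ring

theorem sum_le_sumLargest {n : ℕ} (x : Fin n → ℝ) (s : Finset (Fin n)) :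
    ∑ i ∈ s, x i ≤ sumLargest n s.card x :=
  le_csSup (Set.toFinite _).bddAbove ⟨s, rfl, rfl⟩

theorem sumLargest_pos {n r : ℕ} (hr : 1 ≤ r) (hrn : r ≤ n) {x : Fin n → ℝ}
    (hx : ∀ i, 0 < x i) : 0 < sumLargest n r x := by
  obtain ⟨s, -, rfl⟩ := Finset.exists_subset_card_eq
    (show r ≤ (Finset.univ : Finset (Fin n)).card by simpa using hrn)
  exact (Finset.sum_pos (fun i _ => hx i) (Finset.card_pos.1 hr)).trans_le
    (sum_le_sumLargest x s)

/-- For `1 ≤ r ≤ n`, the sum of the `r` largest entries is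
log-log convex on `ℝⁿ₊₊`. -/
theorem stmt_14 (n r : ℕ) (hr : 1 ≤ r) (hrn : r ≤ n) (x y : Fin n → ℝ)
    (hx : ∀ i, 0 < x i) (hy : ∀ i, 0 < y i) :
    ∀ θ ∈ Set.Icc (0:ℝ) 1,
      sumLargest n r (fun i => x i ^ θ * y i ^ (1 - θ)) ≤
        sumLargest n r x ^ θ * sumLargest n r y ^ (1 - θ) := by
  intro θ hθ
  obtain ⟨t, -, ht⟩ := Finset.exists_subset_card_eq
    (show r ≤ (Finset.univ : Finset (Fin n)).card by simpa using hrn)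
  refine csSup_le ⟨_, t, ht, rfl⟩ ?_
  rintro _ ⟨s, rfl, rfl⟩
  exact sum_rpow_mul_rpow_le s (fun i _ => (hx i).le) (fun i _ => (hy i).le)
    (sumLargest_pos hr hrn hx) (sumLargest_pos hr hrn hy)
    (sum_le_sumLargest x s) (sum_le_sumLargest y s) hθ
end
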